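/- Deterministic prediction bound for the SOFAR minimizer (Lemma A.1): Let X be a real n×p matrix, E a real n×q matrix, and Y = X U* D* V*ᵀ + E, where U* is p×q, V* is q×q, and D* is diagonal q×q with nonnegative entries. Let Û, V̂, D̂ be matrices of the same respective sizes with D̂ diagonal with nonnegative entries, let D̂⁻ be the diagonal matrix with entries 1/d̂_j if d̂_j > 0 and 0 otherwise, and set Â = ÛD̂, B̂ = V̂D̂, A* = U*D*, B* = V*D*, Ĉ = ÛD̂V̂ᵀ, C* = U*D*V*ᵀ. Let λ_d, λ_a, λ_b ≥ 0 and let ρ_a and ρ_b be real-valued functions on matrices satisfying |ρ_h(M) − ρ_h(N)| ≤ ‖M − N‖₁ for all matrices M, N of the same size. Assume (i) the dual-norm conditions ‖n⁻¹ Xᵀ E B̂ D̂⁻‖_∞ ≤ λ_a, ‖n⁻¹ U*ᵀ Xᵀ E B̂ D̂⁻‖_∞ ≤ λ_d, ‖n⁻¹ U*ᵀ Xᵀ E‖_∞ ≤ λ_b, and (ii) the objective comparison (2n)⁻¹‖Y − XĈ‖_F² + λ_d‖D̂‖₁ + λ_a ρ_a(Â) + λ_b ρ_b(B̂) ≤ (2n)⁻¹‖Y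 − XC*‖_F² + λ_d‖D*‖₁ + λ_a ρ_a(A*) + λ_b ρ_b(B*). Then, with λ_max = max(λ_d, λ_a, λ_b), one has n⁻¹‖X(Ĉ − C*)‖_F² ≤ 4 λ_max (‖D̂ − D*‖₁ + ‖Â − A*‖₁ + ‖B̂ − B*‖₁). -/

import Mathlib

open Matrix BigOperators

/-- Frobenius norm of a real matrix. -/
noncomputable def frobNorm {m n : ℕ} (M : Matrix (Fin m) (Fin n) ℝ) : ℝ :=
  Real.sqrt (∑ i, ∑ j, (M i j) ^ 2)

/-- Entrywise ℓ₁-norm of a real matrix. -/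
noncomputable def l1Norm {m n : ℕ} (M : Matrix (Fin m) (Fin n) ℝ) : ℝ :=
  ∑ i, ∑ j, |M i j|

/-- Entrywise sup-norm of a real matrix. -/
noncomputable def supNorm {m n : ℕ} (M : Matrix (Fin m) (Fin n) ℝ) : ℝ :=
  ⨆ i, ⨆ j, |M i j|

/-- The pseudo-inverse `D⁻` of a diagonal matrix `D = diag(d)` with nonnegative entries:
its `j`-th diagonal entry is `1/d_j` if `d_j > 0` and `0` otherwise. -/
noncomputable def diagPseudoInv {q : ℕ} (d : Fin q → ℝ) : Matrix (Fin q) (Fin q) ℝ :=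
  Matrix.diagonal (fun j => if 0 < d j then (d j)⁻¹ else 0)

lemma sofar_le_supNorm {m n : ℕ} (M : Matrix (Fin m) (Fin n) ℝ) (i : Fin m) (j : Fin n) :
    |M i j| ≤ supNorm M := by
  unfold supNorm
  have h1 : |M i j| ≤ ⨆ j, |M i j| :=
    le_ciSup (f := fun j => |M i j|) (Set.finite_range _).bddAbove j
  exact h1.trans
    (le_ciSup (f := fun i => ⨆ j, |M i j|) (Set.finite_range _).bddAbove i)

lemma sofar_trace {m n : ℕ} (M N : Matrix (Fin m) (Fin n) ℝ) :
    (Mᵀ * N).trace = ∑ i, ∑ j, M i j * N i j := by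
  simp only [Matrix.trace, Matrix.diag, Matrix.mul_apply, Matrix.transpose_apply]
  exact Finset.sum_comm

lemma sofar_holder {m n : ℕ} (c l : ℝ) (M N : Matrix (Fin m) (Fin n) ℝ)
    (h : supNorm (c • M) ≤ l) : c * (Mᵀ * N).trace ≤ l * l1Norm N := by
  rw [sofar_trace, l1Norm]
  simp only [Finset.mul_sum]
  refine Finset.sum_le_sum fun i _ => Finset.sum_le_sum fun j _ => ?_
  have h1 := (sofar_le_supNorm (c • M) i j).trans h
  calc c * (M i j * N i j) = (c • M) i j * N i j := by
        simp [mul_assoc]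
    _ ≤ |(c • M) i j * N i j| := le_abs_self _
    _ = |(c • M) i j| * |N i j| := abs_mul _ _
    _ ≤ l * |N i j| := mul_le_mul_of_nonneg_right h1 (abs_nonneg _)

lemma sofar_frob {m n : ℕ} (M : Matrix (Fin m) (Fin n) ℝ) :
    frobNorm M ^ 2 = ∑ i, ∑ j, (M i j) ^ 2 := by
  unfold frobNorm
  exact Real.sq_sqrt (by positivity)

lemma sofar_frob_sub {m n : ℕ} (M N : Matrix (Fin m) (Fin n) ℝ) :
    frobNorm (M - N) ^ 2 = frobNorm M ^ 2 - 2 * (Mᵀ * N).trace + frobNorm N ^ 2 := by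
  rw [sofar_frob, sofar_frob, sofar_frob, sofar_trace]
  simp only [Finset.mul_sum, ← Finset.sum_sub_distrib, ← Finset.sum_add_distrib]
  refine Finset.sum_congr rfl fun i _ => Finset.sum_congr rfl fun j _ => ?_
  simp only [Matrix.sub_apply]; ring

lemma sofar_l1_comm {m n : ℕ} (M N : Matrix (Fin m) (Fin n) ℝ) :
    l1Norm (M - N) = l1Norm (N - M) := by
  simp only [l1Norm, Matrix.sub_apply, abs_sub_comm]

lemma sofar_l1_transpose {m n : ℕ} (M : Matrix (Fin m) (Fin n) ℝ) :
    l1Norm Mᵀ = l1Norm M := by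
  simp only [l1Norm, Matrix.transpose_apply]
  exact Finset.sum_comm

lemma sofar_l1_nonneg {m n : ℕ} (M : Matrix (Fin m) (Fin n) ℝ) : 0 ≤ l1Norm M := by
  unfold l1Norm; positivity

lemma sofar_l1_tri {m n : ℕ} (M N : Matrix (Fin m) (Fin n) ℝ) :
    l1Norm N - l1Norm M ≤ l1Norm (M - N) := by
  simp only [l1Norm, ← Finset.sum_sub_distrib]
  refine Finset.sum_le_sum fun i _ => Finset.sum_le_sum fun j _ => ?_
  rw [Matrix.sub_apply, abs_sub_comm]
  exact abs_sub_abs_le_abs_sub _ _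

lemma sofar_pinv {p q : ℕ} (d : Fin q → ℝ) (hd : ∀ j, 0 ≤ d j)
    (V : Matrix (Fin p) (Fin q) ℝ) :
    V * Matrix.diagonal d * diagPseudoInv d * Matrix.diagonal d = V * Matrix.diagonal d := by
  unfold diagPseudoInv
  ext i j
  simp only [Matrix.mul_diagonal]
  rcases (hd j).lt_or_eq with h | h
  · simp [h, h.ne']
  · simp [← h]

/-- Deterministic prediction bound for the SOFAR minimizer (Lemma A.1): under the
dual-norm noise bounds and the objective comparison at `(Û, D̂, V̂)` versus
`(U*, D*, V*)`, one has `n⁻¹‖X(Ĉ − C*)‖_F² ≤ 4 λ_max (‖D̂ − D*‖₁ + ‖Â − A*‖₁ +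
‖B̂ − B*‖₁)` with `λ_max = max(λ_d, λ_a, λ_b)`. -/
theorem sofar_deterministic_prediction_bound {n p q : ℕ} (hn : 0 < n)
    (X : Matrix (Fin n) (Fin p) ℝ) (E : Matrix (Fin n) (Fin q) ℝ)
    (Uhat Ustar : Matrix (Fin p) (Fin q) ℝ)
    (Vhat Vstar : Matrix (Fin q) (Fin q) ℝ)
    (dhat dstar : Fin q → ℝ) (hdhat : ∀ j, 0 ≤ dhat j) (hdstar : ∀ j, 0 ≤ dstar j)
    (Y : Matrix (Fin n) (Fin q) ℝ)
    (hY : Y = X * (Ustar * Matrix.diagonal dstar * Vstarᵀ) + E)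
    (lam_d lam_a lam_b : ℝ) (hld : 0 ≤ lam_d) (hla : 0 ≤ lam_a) (hlb : 0 ≤ lam_b)
    (ρa : Matrix (Fin p) (Fin q) ℝ → ℝ) (ρb : Matrix (Fin q) (Fin q) ℝ → ℝ)
    (hρa : ∀ M N : Matrix (Fin p) (Fin q) ℝ, |ρa M - ρa N| ≤ l1Norm (M - N))
    (hρb : ∀ M N : Matrix (Fin q) (Fin q) ℝ, |ρb M - ρb N| ≤ l1Norm (M - N))
    (ha : supNorm ((n : ℝ)⁻¹ •
      (Xᵀ * E * (Vhat * Matrix.diagonal dhat) * diagPseudoInv dhat)) ≤ lam_a)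
    (hd : supNorm ((n : ℝ)⁻¹ •
      (Ustarᵀ * Xᵀ * E * (Vhat * Matrix.diagonal dhat) * diagPseudoInv dhat)) ≤ lam_d)
    (hb : supNorm ((n : ℝ)⁻¹ • (Ustarᵀ * Xᵀ * E)) ≤ lam_b)
    (hobj :
      (2 * n : ℝ)⁻¹ * (frobNorm (Y - X * (Uhat * Matrix.diagonal dhat * Vhatᵀ))) ^ 2
          + lam_d * l1Norm (Matrix.diagonal dhat)
          + lam_a * ρa (Uhat * Matrix.diagonal dhat)
          + lam_b * ρb (Vhat * Matrix.diagonal dhat) ≤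
        (2 * n : ℝ)⁻¹ * (frobNorm (Y - X * (Ustar * Matrix.diagonal dstar * Vstarᵀ))) ^ 2
          + lam_d * l1Norm (Matrix.diagonal dstar)
          + lam_a * ρa (Ustar * Matrix.diagonal dstar)
          + lam_b * ρb (Vstar * Matrix.diagonal dstar)) :
    (n : ℝ)⁻¹ * (frobNorm (X * (Uhat * Matrix.diagonal dhat * Vhatᵀ
        - Ustar * Matrix.diagonal dstar * Vstarᵀ))) ^ 2 ≤
      4 * max lam_d (max lam_a lam_b) *
        (l1Norm (Matrix.diagonal dhat - Matrix.diagonal dstar)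
          + l1Norm (Uhat * Matrix.diagonal dhat - Ustar * Matrix.diagonal dstar)
          + l1Norm (Vhat * Matrix.diagonal dhat - Vstar * Matrix.diagonal dstar)) := by
  have hn' : (0 : ℝ) < n := by exact_mod_cast hn
  set P := Vhat * Matrix.diagonal dhat * diagPseudoInv dhat with hP
  have hPD : P * Matrix.diagonal dhat = Vhat * Matrix.diagonal dhat := sofar_pinv dhat hdhat Vhat
  have hPDt : Matrix.diagonal dhat * Pᵀ = Matrix.diagonal dhat * Vhatᵀ := by
    have := congrArg Matrix.transpose hPD
    simpa [Matrix.transpose_mul, Matrix.diagonal_transpose] using this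
  set Δ := Uhat * Matrix.diagonal dhat * Vhatᵀ - Ustar * Matrix.diagonal dstar * Vstarᵀ with hΔ
  have hdec : Δ = (Uhat * Matrix.diagonal dhat - Ustar * Matrix.diagonal dstar) * Pᵀ
      + Ustar * (Matrix.diagonal dstar - Matrix.diagonal dhat) * Pᵀ
      + Ustar * (Vhat * Matrix.diagonal dhat - Vstar * Matrix.diagonal dstar)ᵀ := by
    simp only [hΔ, Matrix.transpose_sub, Matrix.transpose_mul, Matrix.diagonal_transpose,
      Matrix.sub_mul, Matrix.mul_sub, Matrix.mul_assoc, hPDt]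
    abel
  have htr : (Eᵀ * (X * Δ)).trace =
      ((Xᵀ * E * P)ᵀ * (Uhat * Matrix.diagonal dhat - Ustar * Matrix.diagonal dstar)).trace
      + ((Ustarᵀ * Xᵀ * E * P)ᵀ * (Matrix.diagonal dstar - Matrix.diagonal dhat)).trace
      + ((Ustarᵀ * Xᵀ * E)ᵀ *
          (Vhat * Matrix.diagonal dhat - Vstar * Matrix.diagonal dstar)ᵀ).trace := by
    rw [hdec]
    generalize Uhat * Matrix.diagonal dhat - Ustar * Matrix.diagonal dstar = A
    generalize Matrix.diagonal dstar - Matrix.diagonal dhat = D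
    generalize (Vhat * Matrix.diagonal dhat - Vstar * Matrix.diagonal dstar)ᵀ = B
    have e1 : ((Xᵀ * E * P)ᵀ * A).trace = (Eᵀ * (X * (A * Pᵀ))).trace := by
      rw [← Matrix.mul_assoc X, ← Matrix.mul_assoc Eᵀ, Matrix.trace_mul_comm (Eᵀ * (X * A))]
      simp only [Matrix.transpose_mul, Matrix.transpose_transpose, Matrix.mul_assoc]
    have e2 : ((Ustarᵀ * Xᵀ * E * P)ᵀ * D).trace = (Eᵀ * (X * (Ustar * D * Pᵀ))).trace := by
      rw [← Matrix.mul_assoc X, ← Matrix.mul_assoc Eᵀ,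
        Matrix.trace_mul_comm (Eᵀ * (X * (Ustar * D)))]
      simp only [Matrix.transpose_mul, Matrix.transpose_transpose, Matrix.mul_assoc]
    rw [e1, e2]
    simp only [Matrix.transpose_mul, Matrix.transpose_transpose, Matrix.mul_assoc,
      Matrix.mul_add, Matrix.trace_add]
  have hY1 : Y - X * (Uhat * Matrix.diagonal dhat * Vhatᵀ) = E - X * Δ := by
    rw [hY, hΔ, Matrix.mul_sub]; abel
  have hY2 : Y - X * (Ustar * Matrix.diagonal dstar * Vstarᵀ) = E := by
    rw [hY]; abel
  rw [hY1, hY2, sofar_frob_sub] at hobj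
  have ha1 : Xᵀ * E * (Vhat * Matrix.diagonal dhat) * diagPseudoInv dhat = Xᵀ * E * P := by
    simp only [hP, Matrix.mul_assoc]
  have hd1 : Ustarᵀ * Xᵀ * E * (Vhat * Matrix.diagonal dhat) * diagPseudoInv dhat
      = Ustarᵀ * Xᵀ * E * P := by
    simp only [hP, Matrix.mul_assoc]
  rw [ha1] at ha
  rw [hd1] at hd
  have h1 := sofar_holder _ _ _
    (Uhat * Matrix.diagonal dhat - Ustar * Matrix.diagonal dstar) ha
  have h2 := sofar_holder _ _ _ (Matrix.diagonal dstar - Matrix.diagonal dhat) hd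
  have h3 := sofar_holder _ _ _
    (Vhat * Matrix.diagonal dhat - Vstar * Matrix.diagonal dstar)ᵀ hb
  rw [sofar_l1_comm] at h2
  rw [sofar_l1_transpose] at h3
  have h4 := mul_le_mul_of_nonneg_left
    (sofar_l1_tri (Matrix.diagonal dhat) (Matrix.diagonal dstar)) hld
  have h5 := mul_le_mul_of_nonneg_left ((neg_le_abs _).trans
    (hρa (Uhat * Matrix.diagonal dhat) (Ustar * Matrix.diagonal dstar))) hla
  have h6 := mul_le_mul_of_nonneg_left ((neg_le_abs _).trans
    (hρb (Vhat * Matrix.diagonal dhat) (Vstar * Matrix.diagonal dstar))) hlb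
  have m1 := mul_le_mul_of_nonneg_right (le_max_left lam_d (max lam_a lam_b))
    (sofar_l1_nonneg (Matrix.diagonal dhat - Matrix.diagonal dstar))
  have m2 := mul_le_mul_of_nonneg_right
    ((le_max_left lam_a lam_b).trans (le_max_right lam_d (max lam_a lam_b)))
    (sofar_l1_nonneg (Uhat * Matrix.diagonal dhat - Ustar * Matrix.diagonal dstar))
  have m3 := mul_le_mul_of_nonneg_right
    ((le_max_right lam_a lam_b).trans (le_max_right lam_d (max lam_a lam_b)))
    (sofar_l1_nonneg (Vhat * Matrix.diagonal dhat - Vstar * Matrix.diagonal dstar))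
  have htr' := congrArg (fun t => (n : ℝ)⁻¹ * t) htr
  simp only [mul_add] at htr'
  rw [mul_inv] at hobj
  linarith
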